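/- Let f, g ∈ usc-fcns(S) be Lipschitz continuous (hence real-valued) with a common Lipschitz modulus κ ∈ [0,∞) with respect to the sup-norm on S. Then for every x ∈ S, |f(x) − g(x)| ≤ (1 + κ) e^{ρ(x)} dl(f,g), where ρ(x) = max{‖x‖_∞, |f(x)|, |g(x)|}. -/

import Mathlib

open Filter Topology MeasureTheory Metric Set
open scoped Classical ENNReal NNReal

noncomputable section

variable {n : ℕ}

/-- The hypograph of `f : S → [-∞,∞]`, a subset of `S × ℝ`. -/
def hypo {S : Set (Fin n → ℝ)} (f : S → EReal) : Set (S × ℝ) :=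
  {p | (p.2 : EReal) ≤ f p.1}

/-- The space of upper semicontinuous functions on `S`: those whose hypograph is
nonempty and closed in `S × ℝ` (sup-norm metric). -/
def UscFcns (S : Set (Fin n → ℝ)) : Set (S → EReal) :=
  {f | (hypo f).Nonempty ∧ IsClosed (hypo f)}

/-- Hypo-convergence of a sequence of functions on `S`. -/
def HypoConverges {S : Set (Fin n → ℝ)} (fseq : ℕ → S → EReal) (f : S → EReal) : Prop :=
  (∀ (x : S) (xseq : ℕ → S), Tendsto xseq atTop (𝓝 x) →
     Filter.limsup (fun ν => fseq ν (xseq ν)) atTop ≤ f x) ∧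
  (∀ x : S, ∃ xseq : ℕ → S, Tendsto xseq atTop (𝓝 x) ∧
     f x ≤ Filter.liminf (fun ν => fseq ν (xseq ν)) atTop)

/-- Piecewise affine functions of difference-of-max type: on `S ∩ ρ𝔹∞` equal to a
difference of maxima of `q` affine functions, `-∞` elsewhere. -/
def PaFcns (S : Set (Fin n → ℝ)) (q : ℕ) (ρ : ℝ) : Set (S → EReal) :=
  {f | ∃ (a b : Fin q → Fin n → ℝ) (α β : Fin q → ℝ), ∀ x : S,
      (‖(x : Fin n → ℝ)‖ ≤ ρ →
        f x = (((⨆ k : Fin q, ((∑ i, a k i * (x : Fin n → ℝ) i) + α k)) -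
                (⨆ k : Fin q, ((∑ i, b k i * (x : Fin n → ℝ) i) + β k)) : ℝ) : EReal)) ∧
      (¬ ‖(x : Fin n → ℝ)‖ ≤ ρ → f x = ⊥)}

/-- ρ-Attouch-Wets distance between hypographs. -/
def awDistRho {S : Set (Fin n → ℝ)} (f g : S → EReal) (ρ : ℝ) : ℝ :=
  sSup ((fun z : S × ℝ => |infDist z (hypo f) - infDist z (hypo g)|) ''
    {z : S × ℝ | ‖(z.1 : Fin n → ℝ)‖ ≤ ρ ∧ |z.2| ≤ ρ})

/-- The Attouch-Wets distance. -/
def awDist {S : Set (Fin n → ℝ)} (f g : S → EReal) : ℝ :=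
  ∫ ρ in Set.Ioi (0 : ℝ), awDistRho f g ρ * Real.exp (-ρ)

/-- The auxiliary quantity `d̂l_ρ`. -/
def dlHat {S : Set (Fin n → ℝ)} (f g : S → EReal) (ρ : ℝ) : ℝ :=
  sInf {τ : ℝ | 0 ≤ τ ∧
    (∀ x : S, ‖(x : Fin n → ℝ)‖ ≤ ρ → ((-ρ : ℝ) : EReal) ≤ f x →
        min (f x) ((ρ : ℝ) : EReal) + ((τ : ℝ) : EReal) ≤
          ⨆ y : S, ⨆ (_ : dist y x ≤ τ), g y) ∧
    (∀ x : S, ‖(x : Fin n → ℝ)‖ ≤ ρ → ((-ρ : ℝ) : EReal) ≤ g x →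
        min (g x) ((ρ : ℝ) : EReal) + ((τ : ℝ) : EReal) ≤
          ⨆ y : S, ⨆ (_ : dist y x ≤ τ), f y)}

/-- `ε`-argmin of `φ` over `D` (with the paper's conventions automatic in `EReal`). -/
def eArgmin {S : Set (Fin n → ℝ)} (D : Set (S → EReal)) (φ : (S → EReal) → EReal) (ε : ℝ) :
    Set (S → EReal) :=
  {f ∈ D | φ f ≤ sInf (φ '' D) + (ε : EReal)}

/-- `F` is closed in the metric space `(usc-fcns(S), dl)`. -/
def AwClosed (S : Set (Fin n → ℝ)) (F : Set (S → EReal)) : Prop :=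
  ∀ f ∈ UscFcns S, (∀ ε : ℝ, 0 < ε → ∃ g ∈ F, awDist f g < ε) → f ∈ F

/-- `F` is bounded in `(usc-fcns(S), dl)`, i.e. contained in some dl-ball. -/
def AwBounded {S : Set (Fin n → ℝ)} (F : Set (S → EReal)) : Prop :=
  ∃ (g : S → EReal) (r : ℝ), ∀ f ∈ F, awDist g f ≤ r

/-- Lower semicontinuity of `φ` on `D` with respect to the Attouch-Wets distance. -/
def AwLscOn {S : Set (Fin n → ℝ)} (D : Set (S → EReal)) (φ : (S → EReal) → EReal) : Prop :=
  ∀ f ∈ D, ∀ fseq : ℕ → (S → EReal), (∀ k, fseq k ∈ D) →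
    Tendsto (fun k => awDist (fseq k) f) atTop (𝓝 (0 : ℝ)) →
    φ f ≤ Filter.liminf (fun k => φ (fseq k)) atTop

/-- Continuity of `φ` on `D` with respect to the Attouch-Wets distance. -/
def AwContinuousOn {S : Set (Fin n → ℝ)} (D : Set (S → EReal)) (φ : (S → EReal) → EReal) : Prop :=
  ∀ f ∈ D, ∀ fseq : ℕ → (S → EReal), (∀ k, fseq k ∈ D) →
    Tendsto (fun k => awDist (fseq k) f) atTop (𝓝 (0 : ℝ)) →
    Tendsto (fun k => φ (fseq k)) atTop (𝓝 (φ f))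

/-- The outer limit of a sequence of subsets of `(usc-fcns(S), dl)`. -/
def awOutLim {S : Set (Fin n → ℝ)} (A : ℕ → Set (S → EReal)) : Set (S → EReal) :=
  {f | ∃ idx : ℕ → ℕ, StrictMono idx ∧ ∃ a : ℕ → (S → EReal), (∀ k, a k ∈ A (idx k)) ∧
       Tendsto (fun k => awDist (a k) f) atTop (𝓝 (0 : ℝ))}

/-- Excess of `A` over `B` in `(usc-fcns(S), dl)`. -/
def exs {S : Set (Fin n → ℝ)} (A B : Set (S → EReal)) : EReal :=
  if A = ∅ then 0 else if B = ∅ then ⊤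
  else ⨆ f ∈ A, ⨅ g ∈ B, ((awDist f g : ℝ) : EReal)

/-- Pompeiu-Hausdorff distance in `(usc-fcns(S), dl)`. -/
def awHausdorff {S : Set (Fin n → ℝ)} (A B : Set (S → EReal)) : EReal :=
  max (exs A B) (exs B A)

/-- The Borel σ-algebra of `(usc-fcns(S), dl)`, generated by the dl-balls. -/
def awMS (S : Set (Fin n → ℝ)) : MeasurableSpace (S → EReal) :=
  MeasurableSpace.generateFrom
    {B : Set (S → EReal) | ∃ (f : S → EReal) (r : ℝ), B = {g : S → EReal | awDist f g < r}}

/-- The positive part of an extended real, as an element of `ℝ≥0∞`. -/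
def erealPos (x : EReal) : ℝ≥0∞ := if x = ⊤ then ⊤ else ENNReal.ofReal x.toReal

/-- The expectation `∫ h dP = ∫ max(0,h) dP - ∫ max(0,-h) dP`, with `∞ - ∞ = ∞`. -/
def eExp {Ξ : Type*} [MeasurableSpace Ξ] (P : Measure Ξ) (h : Ξ → EReal) : EReal :=
  if (∫⁻ ξ, erealPos (h ξ) ∂P) = ⊤ then ⊤
  else if (∫⁻ ξ, erealPos (-(h ξ)) ∂P) = ⊤ then ⊥
  else ((((∫⁻ ξ, erealPos (h ξ) ∂P).toReal - (∫⁻ ξ, erealPos (-(h ξ)) ∂P).toReal : ℝ)) : EReal)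

/-- A random lower semicontinuous function on `Ξ × F`. -/
def RandomLscFn {Ξ : Type*} (mΞ : MeasurableSpace Ξ) {S : Set (Fin n → ℝ)}
    (F : Set (S → EReal)) (ψ : Ξ → (S → EReal) → EReal) : Prop :=
  (∀ ξ : Ξ, AwLscOn F (ψ ξ)) ∧
  @Measurable (Ξ × F) EReal (mΞ.prod ((awMS S).comap Subtype.val)) inferInstance
    (fun p => ψ p.1 p.2.1)

/-- Local inf-integrability of a random lsc function. -/
def LocInfIntegrable {Ξ : Type*} [MeasurableSpace Ξ] (P : Measure Ξ) {S : Set (Fin n → ℝ)}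
    (F : Set (S → EReal)) (ψ : Ξ → (S → EReal) → EReal) : Prop :=
  ∀ f ∈ F, ∃ ρ : ℝ, 0 < ρ ∧
    ⊥ < eExp P (fun ξ => sInf ((fun g => ψ ξ g) '' {g ∈ F | awDist g f ≤ ρ}))

/-- `Y` is sub-exponential under `P`: a.s. finite and, for some `λ ≥ 0`,
`E[exp(τ(Y - E Y))] ≤ exp(τ²λ²/2)` whenever `|τ| ≤ 1/λ`. -/
def SubExponential {Ξ : Type*} [MeasurableSpace Ξ] (P : Measure Ξ) (Y : Ξ → EReal) : Prop :=
  (∀ᵐ ξ ∂P, Y ξ ≠ ⊤ ∧ Y ξ ≠ ⊥) ∧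
  ∃ l : ℝ, 0 ≤ l ∧ ∀ τ : ℝ, |τ| * l ≤ 1 →
    (∫ ξ, Real.exp (τ * ((Y ξ).toReal - ∫ ξ', (Y ξ').toReal ∂P)) ∂P) ≤
      Real.exp (τ ^ 2 * l ^ 2 / 2)

/-- Sample average `(1/ν) ∑_{j=1}^ν ψ(ξ^j, f)`. -/
def sampleAvg {Ξ : Type*} {S : Set (Fin n → ℝ)} (ψ : Ξ → (S → EReal) → EReal)
    (ν : ℕ) (ω : Fin ν → Ξ) (f : S → EReal) : EReal :=
  (((1 : ℝ) / ν : ℝ) : EReal) * ∑ j : Fin ν, ψ (ω j) f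


/-- The values whose supremum defines `awDistRho f g ρ` grow at most linearly in `ρ`. -/
theorem abs_infDist_hypo_sub_le {S : Set (Fin n → ℝ)} {f g : S → EReal} {o p q z : S × ℝ}
    (ho : o.1 = (0 : Fin n → ℝ) ∧ o.2 = 0) (hp : p ∈ hypo f) (hq : q ∈ hypo g) {ρ : ℝ}
    (hz : ‖(z.1 : Fin n → ℝ)‖ ≤ ρ ∧ |z.2| ≤ ρ) :
    |infDist z (hypo f) - infDist z (hypo g)| ≤ ρ + (dist o p + dist o q) := by
  have hzo : dist z o ≤ ρ := by
    rw [Prod.dist_eq, Subtype.dist_eq, ho.1, ho.2, dist_zero_right, dist_zero_right]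
    exact max_le hz.1 hz.2
  have hf := infDist_le_dist_of_mem (x := z) hp
  have hg := infDist_le_dist_of_mem (x := z) hq
  have hzp := dist_triangle z o p
  have hzq := dist_triangle z o q
  have hop : 0 ≤ dist o p := dist_nonneg
  have hoq : 0 ≤ dist o q := dist_nonneg
  have hf0 : 0 ≤ infDist z (hypo f) := infDist_nonneg
  have hg0 : 0 ≤ infDist z (hypo g) := infDist_nonneg
  rw [abs_le]
  constructor <;> linarith

theorem bddAbove_awDistRho {S : Set (Fin n → ℝ)} (hS0 : (0 : Fin n → ℝ) ∈ S) {f g : S → EReal}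
    (hf : (hypo f).Nonempty) (hg : (hypo g).Nonempty) (ρ : ℝ) :
    BddAbove ((fun z : S × ℝ => |infDist z (hypo f) - infDist z (hypo g)|) ''
      {z : S × ℝ | ‖(z.1 : Fin n → ℝ)‖ ≤ ρ ∧ |z.2| ≤ ρ}) := by
  obtain ⟨p, hp⟩ := hf
  obtain ⟨q, hq⟩ := hg
  refine ⟨ρ + (dist (⟨0, hS0⟩, 0) p + dist (⟨0, hS0⟩, 0) q), ?_⟩
  rintro _ ⟨z, hz, rfl⟩
  exact abs_infDist_hypo_sub_le (o := (⟨0, hS0⟩, 0)) ⟨rfl, rfl⟩ hp hq hz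

theorem awDistRho_nonneg {S : Set (Fin n → ℝ)} (f g : S → EReal) (ρ : ℝ) :
    0 ≤ awDistRho f g ρ := by
  apply Real.sSup_nonneg
  rintro _ ⟨z, -, rfl⟩
  exact abs_nonneg _

theorem awDistRho_monotoneOn {S : Set (Fin n → ℝ)} (hS0 : (0 : Fin n → ℝ) ∈ S) {f g : S → EReal}
    (hf : (hypo f).Nonempty) (hg : (hypo g).Nonempty) :
    MonotoneOn (awDistRho f g) (Ioi 0) := by
  intro a ha b _ hab
  refine csSup_le_csSup (bddAbove_awDistRho hS0 hf hg b) ?_ ?_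
  · have ha' : (0 : ℝ) ≤ a := le_of_lt ha
    exact ⟨_, (⟨0, hS0⟩, 0), by simpa using ha', rfl⟩
  · exact image_mono fun z hz => ⟨hz.1.trans hab, hz.2.trans hab⟩

theorem integrableOn_awDistRho_mul_exp {S : Set (Fin n → ℝ)} (hS0 : (0 : Fin n → ℝ) ∈ S)
    {f g : S → EReal} (hf : (hypo f).Nonempty) (hg : (hypo g).Nonempty) :
    IntegrableOn (fun ρ => awDistRho f g ρ * Real.exp (-ρ)) (Ioi 0) := by
  obtain ⟨p, hp⟩ := id hf
  obtain ⟨q, hq⟩ := id hg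
  set o : S × ℝ := (⟨0, hS0⟩, 0)
  set C := dist o p + dist o q
  have hC : 0 ≤ C := by positivity
  have hdom : IntegrableOn (fun ρ : ℝ => (C + 2) * Real.exp (-(1 / 2) * ρ)) (Ioi 0) :=
    (exp_neg_integrableOn_Ioi 0 (by norm_num : (0 : ℝ) < 1 / 2)).const_mul _
  refine Integrable.mono' hdom ?_ ?_
  · exact ((aemeasurable_restrict_of_monotoneOn measurableSet_Ioi
      (awDistRho_monotoneOn hS0 hf hg)).mul
        (Real.measurable_exp.comp measurable_neg).aemeasurable).aestronglyMeasurable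
  · refine (ae_restrict_iff' measurableSet_Ioi).2 (ae_of_all _ fun ρ hρ => ?_)
    have hρ' : (0 : ℝ) < ρ := hρ
    have hle : awDistRho f g ρ ≤ ρ + C := by
      apply Real.sSup_le
      · rintro _ ⟨z, hz, rfl⟩
        exact abs_infDist_hypo_sub_le ⟨rfl, rfl⟩ hp hq hz
      · linarith
    have hexp : ρ + C ≤ (C + 2) * Real.exp (ρ / 2) := by
      nlinarith [Real.add_one_le_exp (ρ / 2)]
    rw [Real.norm_of_nonneg (mul_nonneg (awDistRho_nonneg f g ρ) (Real.exp_pos _).le)]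
    calc awDistRho f g ρ * Real.exp (-ρ)
        ≤ (C + 2) * Real.exp (ρ / 2) * Real.exp (-ρ) := by
          gcongr
          exact hle.trans hexp
      _ = (C + 2) * Real.exp (-(1 / 2) * ρ) := by
          rw [mul_assoc, ← Real.exp_add]
          ring_nf

/-- A lower bound for the `ρ`-distances at `ρ = r` bounds the Attouch-Wets distance. -/
theorem mul_exp_neg_le_awDist {S : Set (Fin n → ℝ)} (hS0 : (0 : Fin n → ℝ) ∈ S)
    {f g : S → EReal} (hf : (hypo f).Nonempty) (hg : (hypo g).Nonempty) {c r : ℝ} (hr : 0 ≤ r)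
    (hc : ∀ ρ, r < ρ → c ≤ awDistRho f g ρ) :
    c * Real.exp (-r) ≤ awDist f g := by
  have hint := integrableOn_awDistRho_mul_exp hS0 hf hg
  have hsub : Ioi r ⊆ Ioi (0 : ℝ) := Ioi_subset_Ioi hr
  have hexp : IntegrableOn (fun ρ : ℝ => Real.exp (-ρ)) (Ioi r) := by
    simpa using exp_neg_integrableOn_Ioi r one_pos
  calc c * Real.exp (-r) = ∫ ρ in Ioi r, c * Real.exp (-ρ) := by
        rw [integral_const_mul, integral_exp_neg_Ioi]
    _ ≤ ∫ ρ in Ioi r, awDistRho f g ρ * Real.exp (-ρ) :=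
        setIntegral_mono_on (hexp.const_mul c) (hint.mono_set hsub) measurableSet_Ioi
          fun ρ hρ => mul_le_mul_of_nonneg_right (hc ρ hρ) (Real.exp_pos _).le
    _ ≤ awDist f g := by
        refine setIntegral_mono_set hint (ae_of_all _ fun ρ => ?_) hsub.eventuallyLE
        exact mul_nonneg (awDistRho_nonneg f g ρ) (Real.exp_pos _).le

/-- For `g` Lipschitz with modulus `κ`, the vertical gap to the graph of `g` is at most `1 + κ`
times the distance to the hypograph. -/
theorem sub_le_mul_infDist_hypo {S : Set (Fin n → ℝ)} {g : S → ℝ} {κ : ℝ} (hκ : 0 ≤ κ)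
    (hgL : ∀ x y : S, |g x - g y| ≤ κ * dist x y) (x : S) (α : ℝ) :
    α - g x ≤ (1 + κ) * infDist (x, α) (hypo fun x : S => ((g x : ℝ) : EReal)) := by
  have hne : (hypo fun x : S => ((g x : ℝ) : EReal)).Nonempty :=
    ⟨(x, g x), le_refl ((g x : ℝ) : EReal)⟩
  rw [← div_le_iff₀' (by linarith), le_infDist hne]
  rintro ⟨y, β⟩ hy
  have hβ : β ≤ g y := EReal.coe_le_coe_iff.1 hy
  rw [div_le_iff₀' (by linarith)]
  have h1 : dist x y ≤ dist (x, α) (y, β) := le_max_left _ _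
  have h2 : α - β ≤ dist (x, α) (y, β) :=
    (le_abs_self _).trans ((Real.dist_eq α β).ge.trans (le_max_right _ _))
  have h3 := (abs_le.1 (hgL x y)).1
  have h4 := mul_le_mul_of_nonneg_left h1 hκ
  linarith

theorem infDist_hypo_le_awDistRho {S : Set (Fin n → ℝ)} (hS0 : (0 : Fin n → ℝ) ∈ S)
    {f g : S → EReal} (hf : (hypo f).Nonempty) (hg : (hypo g).Nonempty) {ρ : ℝ} {z : S × ℝ}
    (hz : ‖(z.1 : Fin n → ℝ)‖ ≤ ρ ∧ |z.2| ≤ ρ) :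
    |infDist z (hypo f) - infDist z (hypo g)| ≤ awDistRho f g ρ :=
  le_csSup (bddAbove_awDistRho hS0 hf hg ρ) ⟨z, hz, rfl⟩

/-- Proposition 5.5: pointwise bound between Lipschitz continuous usc functions in terms of
the Attouch-Wets distance. -/
theorem pointwise_bound_from_awDist
    {n : ℕ} {S : Set (Fin n → ℝ)} (hSne : S.Nonempty) (hScl : IsClosed S)
    (hS0 : (0 : Fin n → ℝ) ∈ S)
    (f g : S → ℝ) (κ : ℝ) (hκ : 0 ≤ κ)
    (hfL : ∀ x y : S, |f x - f y| ≤ κ * dist x y)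
    (hgL : ∀ x y : S, |g x - g y| ≤ κ * dist x y)
    (hf : (fun x : S => ((f x : ℝ) : EReal)) ∈ UscFcns S)
    (hg : (fun x : S => ((g x : ℝ) : EReal)) ∈ UscFcns S) :
    ∀ x : S, |f x - g x| ≤
      (1 + κ) * Real.exp (max ‖(x : Fin n → ℝ)‖ (max |f x| |g x|)) *
        awDist (fun x : S => ((f x : ℝ) : EReal)) (fun x : S => ((g x : ℝ) : EReal)) := by
  intro x
  set F : S → EReal := fun x => ((f x : ℝ) : EReal)
  set G : S → EReal := fun x => ((g x : ℝ) : EReal)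
  set r := max ‖(x : Fin n → ℝ)‖ (max |f x| |g x|)
  have hxr : ‖(x : Fin n → ℝ)‖ ≤ r := le_max_left _ _
  have hfr : |f x| ≤ r := (le_max_left _ _).trans (le_max_right _ _)
  have hgr : |g x| ≤ r := (le_max_right _ _).trans (le_max_right _ _)
  have hκ1 : 0 < 1 + κ := by linarith
  have hlow : |f x - g x| / (1 + κ) * Real.exp (-r) ≤ awDist F G := by
    refine mul_exp_neg_le_awDist hS0 hf.1 hg.1 ((norm_nonneg _).trans hxr) fun ρ hρ => ?_
    have hdistf := infDist_hypo_le_awDistRho hS0 hf.1 hg.1 (z := (x, f x))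
      ⟨hxr.trans hρ.le, hfr.trans hρ.le⟩
    have hdistg := infDist_hypo_le_awDistRho hS0 hf.1 hg.1 (z := (x, g x))
      ⟨hxr.trans hρ.le, hgr.trans hρ.le⟩
    have hF : infDist (x, f x) (hypo F) = 0 := infDist_zero_of_mem (le_refl (F x))
    have hG : infDist (x, g x) (hypo G) = 0 := infDist_zero_of_mem (le_refl (G x))
    rw [hF, zero_sub, abs_neg, abs_of_nonneg infDist_nonneg] at hdistf
    rw [hG, sub_zero, abs_of_nonneg infDist_nonneg] at hdistg
    have hfg := (sub_le_mul_infDist_hypo hκ hgL x (f x)).trans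
      (mul_le_mul_of_nonneg_left hdistf hκ1.le)
    have hgf := (sub_le_mul_infDist_hypo hκ hfL x (g x)).trans
      (mul_le_mul_of_nonneg_left hdistg hκ1.le)
    rw [div_le_iff₀' hκ1]
    exact abs_sub_le_iff.2 ⟨hfg, hgf⟩
  rw [Real.exp_neg, ← div_eq_mul_inv, div_le_iff₀ (Real.exp_pos r), div_le_iff₀' hκ1] at hlow
  exact hlow.trans_eq (by ring)

end
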